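/- Let Ω ⊊ ℂ be a nonempty connected open set (a domain) which is simply connected. Then there exists a conformal map f from Ω onto the open unit disk 𝔻 = {z ∈ ℂ : |z| < 1}. Moreover, for any two conformal maps f, g from Ω onto 𝔻, the composition f ∘ g⁻¹ : 𝔻 → 𝔻 is the restriction of a Möbius transformation. -/

import Mathlib

open Set Metric Complex Filter MeasureTheory Topology ENNReal NNReal

noncomputable section

/-- A conformal map from `U` onto `V`: an injective holomorphic function on `U` with image `V`. -/
def ConformalMapOnto (f : ℂ → ℂ) (U V : Set ℂ) : Prop :=
  DifferentiableOn ℂ f U ∧ Set.InjOn f U ∧ f '' U = V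

/-- `f` agrees on `U` with a Möbius transformation. -/
def IsMobiusOn (f : ℂ → ℂ) (U : Set ℂ) : Prop :=
  ∃ a b c d : ℂ, a * d - b * c ≠ 0 ∧ ∀ z ∈ U, c * z + d ≠ 0 ∧ f z = (a * z + b) / (c * z + d)

section

open scoped ComplexConjugate

/-- The automorphism of the unit disk that sends `a` to `0`. -/
def discAut (a z : ℂ) : ℂ := (z - a) / (1 - conj a * z)

lemma one_sub_conj_mul_ne_zero {a z : ℂ} (ha : ‖a‖ < 1) (hz : ‖z‖ < 1) : 1 - conj a * z ≠ 0 := by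
  intro h
  have h1 : ‖conj a * z‖ = 1 := by rw [← sub_eq_zero.1 h, norm_one]
  rw [norm_mul, RCLike.norm_conj] at h1
  nlinarith [norm_nonneg a, norm_nonneg z]

lemma norm_discAut_lt_one {a z : ℂ} (ha : ‖a‖ < 1) (hz : ‖z‖ < 1) : ‖discAut a z‖ < 1 := by
  have h0 := one_sub_conj_mul_ne_zero ha hz
  have h1 : ‖1 - conj a * z‖ ^ 2 - ‖z - a‖ ^ 2 = (1 - ‖a‖ ^ 2) * (1 - ‖z‖ ^ 2) := by
    simp only [← Complex.normSq_eq_norm_sq, Complex.normSq_apply]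
    simp
    ring
  have h2 : 0 < (1 - ‖a‖ ^ 2) * (1 - ‖z‖ ^ 2) := by
    apply _root_.mul_pos <;> nlinarith [norm_nonneg a, norm_nonneg z]
  rw [discAut, norm_div, div_lt_one (norm_pos_iff.2 h0)]
  exact lt_of_pow_lt_pow_left₀ 2 (norm_nonneg _) (by linarith)

lemma one_sub_conj_mul_self_ne_zero {a : ℂ} (ha : ‖a‖ < 1) : 1 - conj a * a ≠ 0 :=
  one_sub_conj_mul_ne_zero ha ha

lemma discAut_neg_discAut {a z : ℂ} (ha : ‖a‖ < 1) (hz : ‖z‖ < 1) :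
    discAut (-a) (discAut a z) = z := by
  have h0 := one_sub_conj_mul_ne_zero ha hz
  have h1 := one_sub_conj_mul_self_ne_zero ha
  have h2 : 1 - conj (-a) * ((z - a) / (1 - conj a * z))
      = (1 - conj a * a) / (1 - conj a * z) := by
    rw [map_neg]
    field_simp
    ring
  have h3 : (z - a) / (1 - conj a * z) - -a = z * (1 - conj a * a) / (1 - conj a * z) := by
    rw [sub_neg_eq_add, div_add' _ _ _ h0]
    ring
  rw [discAut, discAut, h2, h3, div_div_div_cancel_right₀ h0, mul_div_cancel_right₀ _ h1]

lemma injOn_discAut {a : ℂ} (ha : ‖a‖ < 1) : InjOn (discAut a) (ball 0 1) :=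
  fun z hz w hw h ↦ by
    rw [← discAut_neg_discAut ha (mem_ball_zero_iff.1 hz), h,
      discAut_neg_discAut ha (mem_ball_zero_iff.1 hw)]

lemma mapsTo_discAut {a : ℂ} (ha : ‖a‖ < 1) : MapsTo (discAut a) (ball 0 1) (ball 0 1) :=
  fun _ hz ↦ mem_ball_zero_iff.2 (norm_discAut_lt_one ha (mem_ball_zero_iff.1 hz))

lemma hasDerivAt_discAut {a z : ℂ} (ha : ‖a‖ < 1) (hz : ‖z‖ < 1) :
    HasDerivAt (discAut a) ((1 - conj a * a) / (1 - conj a * z) ^ 2) z := by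
  have h := ((hasDerivAt_id z).sub_const a).div
    (((hasDerivAt_id z).const_mul (conj a)).const_sub 1) (one_sub_conj_mul_ne_zero ha hz)
  refine h.congr_deriv ?_
  simp only [id]
  ring

lemma differentiableOn_discAut {a : ℂ} (ha : ‖a‖ < 1) :
    DifferentiableOn ℂ (discAut a) (ball 0 1) := fun _ hz ↦
  (hasDerivAt_discAut ha (mem_ball_zero_iff.1 hz)).differentiableAt.differentiableWithinAt

@[simp]
lemma discAut_self (a : ℂ) : discAut a a = 0 := by simp [discAut]

@[simp]
lemma discAut_zero (a : ℂ) : discAut a 0 = -a := by simp [discAut]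

/-- A family of holomorphic maps into the unit disk converges locally uniformly along every
ultrafilter. -/
theorem exists_tendstoLocallyUniformlyOn_ultrafilter {ι : Type*} (l : Ultrafilter ι) {U : Set ℂ}
    (hU : IsOpen U) {F : ι → ℂ → ℂ} (hF : ∀ i, DifferentiableOn ℂ (F i) U)
    (hb : ∀ i, MapsTo (F i) U (ball 0 1)) :
    ∃ f : ℂ → ℂ, TendstoLocallyUniformlyOn F f l U ∧ MapsTo f U (closedBall 0 1) := by
  have hlim : ∀ z ∈ U, ∃ w ∈ closedBall (0 : ℂ) 1, Tendsto (fun i ↦ F i z) l (𝓝 w) := by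
    intro z hz
    refine (isCompact_closedBall (0 : ℂ) 1).ultrafilter_le_nhds (l.map fun i ↦ F i z) ?_
    exact le_principal_iff.2 (Filter.mem_map.2 (Filter.univ_mem' fun i ↦
      ball_subset_closedBall (hb i hz)))
  choose! f hf hlim using hlim
  refine ⟨f, Metric.tendstoLocallyUniformlyOn_iff.2 fun ε hε x hx ↦ ?_, hf⟩
  obtain ⟨r, hr, hrU⟩ := Metric.isOpen_iff.1 hU x hx
  have hlip : ∀ y ∈ ball x r, ∀ i, dist (F i y) (F i x) ≤ 2 / r * dist y x := by
    intro y hy i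
    refine Complex.dist_le_div_mul_dist_of_mapsTo_ball ((hF i).mono hrU) (fun w hw ↦ ?_) hy
    have h1 := mem_ball.1 (hb i (hrU hw))
    have h2 := mem_ball.1 (hb i hx)
    exact mem_closedBall.2 ((dist_triangle_right _ _ 0).trans (by linarith))
  have hlip' : ∀ y ∈ ball x r, dist (f y) (f x) ≤ 2 / r * dist y x := fun y hy ↦
    le_of_tendsto ((hlim y (hrU hy)).dist (hlim x hx)) (Filter.Eventually.of_forall (hlip y hy))
  have hδ : 0 < min r (r * ε / 6) := by positivity
  refine ⟨ball x (min r (r * ε / 6)), mem_nhdsWithin_of_mem_nhds (ball_mem_nhds x hδ), ?_⟩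
  filter_upwards [Metric.tendsto_nhds.1 (hlim x hx) (ε / 3) (by positivity)] with i hi y hy
  have hyr : y ∈ ball x r := ball_subset_ball (min_le_left _ _) hy
  have hyε : 2 / r * dist y x < ε / 3 := by
    have : dist y x < r * ε / 6 := (mem_ball.1 hy).trans_le (min_le_right _ _)
    calc 2 / r * dist y x < 2 / r * (r * ε / 6) := by gcongr
      _ = ε / 3 := by field_simp; norm_num
  calc dist (f y) (F i y) ≤ dist (f y) (f x) + dist (f x) (F i x) + dist (F i x) (F i y) :=
        dist_triangle4 _ _ _ _
    _ < ε / 3 + ε / 3 + ε / 3 := by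
        refine add_lt_add (add_lt_add ((hlip' y hyr).trans_lt hyε) ?_) ?_
        · rwa [dist_comm]
        · rw [dist_comm]
          exact (hlip y hyr i).trans_lt hyε
    _ = ε := by ring

/-- **Hurwitz's theorem** for injective functions. -/
theorem TendstoLocallyUniformlyOn.injOn_of_not_constant {ι : Type*} {l : Filter ι} [l.NeBot]
    {U : Set ℂ} (hU : IsOpen U) (hUc : IsPreconnected U) {F : ι → ℂ → ℂ} {f : ℂ → ℂ}
    (hf : TendstoLocallyUniformlyOn F f l U) (hF : ∀ i, DifferentiableOn ℂ (F i) U)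
    (hinj : ∀ i, InjOn (F i) U) (hne : ¬ ∃ w, ∀ z ∈ U, f z = w) : InjOn f U := by
  intro a ha b hb hab
  by_contra hne_ab
  have hfd : DifferentiableOn ℂ f U := hf.differentiableOn (Filter.Eventually.of_forall hF) hU
  have hfa : AnalyticOnNhd ℂ f U := hfd.analyticOnNhd hU
  have hev : ∀ᶠ z in 𝓝[≠] b, f z ≠ f b := by
    refine ((hfa b hb).eventually_eq_or_eventually_ne analyticAt_const).resolve_left fun h ↦ ?_
    exact hne ⟨f b, hfa.eqOn_of_preconnected_of_eventuallyEq analyticOnNhd_const hUc hb h⟩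
  have hev' : ∀ᶠ z in 𝓝 b, z ∈ U ∧ z ≠ a ∧ (z ≠ b → f z ≠ f b) :=
    (hU.eventually_mem hb).and ((isOpen_ne.eventually_mem (Ne.symm hne_ab)).and
      (eventually_nhdsWithin_iff.1 hev))
  obtain ⟨r, hr, hrb⟩ := Metric.nhds_basis_closedBall.eventually_iff.1 hev'
  have hrU : closedBall b r ⊆ U := fun z hz ↦ (hrb hz).1
  obtain ⟨z₀, hz₀, hmin⟩ := (isCompact_sphere b r).exists_isMinOn
    (NormedSpace.sphere_nonempty.2 hr.le) (f := fun z ↦ ‖f z - f b‖)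
    ((hfd.continuousOn.mono (sphere_subset_closedBall.trans hrU)).sub continuousOn_const).norm
  set m := ‖f z₀ - f b‖ with hm_def
  have hm : 0 < m := norm_pos_iff.2 (sub_ne_zero.2
    ((hrb (sphere_subset_closedBall hz₀)).2.2 (ne_of_mem_sphere hz₀ hr.ne')))
  have hunif := (tendstoLocallyUniformlyOn_iff_tendstoUniformlyOn_of_compact
    (isCompact_closedBall b r)).1 (hf.mono hrU)
  have hev1 := Metric.tendstoUniformlyOn_iff.1 hunif (m / 4) (by positivity)
  have hlim := (hf.tendsto_at ha).dist (hf.tendsto_at hb)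
  rw [hab, dist_self] at hlim
  obtain ⟨i, hi, hi'⟩ := (hev1.and
    (hlim.eventually_lt_const (show 0 < m / 2 / 2 by positivity))).exists
  have hsub := DiffContOnCl.ball_subset_image_closedBall (f := F i) (z₀ := b) (r := r)
    (ε := m / 2) (((hF i).mono hrU).diffContOnCl_ball Subset.rfl) hr
    (fun z hz ↦ by
      have h1 := hi z (sphere_subset_closedBall hz)
      have h2 := hi b (mem_closedBall_self hr.le)
      have h3 : m ≤ dist (f z) (f b) := by rw [dist_eq_norm]; exact hmin hz
      have h4 := dist_triangle4 (f z) (F i z) (F i b) (f b)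
      rw [dist_comm (F i b)] at h4
      rw [← dist_eq_norm]
      linarith)
    (by
      have : ∀ᶠ z in 𝓝[≠] b, F i z ≠ F i b := by
        filter_upwards [self_mem_nhdsWithin, mem_nhdsWithin_of_mem_nhds (hU.mem_nhds hb)]
          with z hz hzU h
        exact hz (hinj i hzU hb h)
      exact this.frequently.filter_mono nhdsWithin_le_nhds)
  obtain ⟨w, hw, hwa⟩ := hsub (mem_ball.2 hi')
  exact (hrb hw).2.1 (hinj i (hrU hw) ha hwa)

/-- A continuous square root of a nonvanishing holomorphic function is holomorphic. -/
lemma hasDerivAt_of_sq_eq {U : Set ℂ} (hU : IsOpen U) {g h : ℂ → ℂ} {g' x : ℂ}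
    (hh : ContinuousOn h U) (hsq : ∀ z, h z ^ 2 = g z) (hx : x ∈ U) (hgx : g x ≠ 0)
    (hg : HasDerivAt g g' x) : HasDerivAt h (g' / (2 * h x)) x := by
  have hx0 : h x ≠ 0 := fun h0 ↦ hgx (by rw [← hsq, h0]; simp)
  have hc : ContinuousAt h x := hh.continuousAt (hU.mem_nhds hx)
  have hsum : Tendsto (fun y ↦ h y + h x) (𝓝[≠] x) (𝓝 (2 * h x)) := by
    rw [two_mul]
    exact (hc.tendsto.add_const _).mono_left nhdsWithin_le_nhds
  have h2 : 2 * h x ≠ 0 := mul_ne_zero two_ne_zero hx0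
  rw [hasDerivAt_iff_tendsto_slope] at hg ⊢
  refine (hg.div hsum h2).congr' ?_
  filter_upwards [hsum.eventually_ne h2] with y hy
  simp only [Pi.div_apply, slope_def_field, ← hsq]
  rw [div_eq_iff hy]
  ring

/-- A simply connected domain other than the plane embeds conformally into the unit disk, with
a prescribed point sent to the origin. -/
theorem exists_injOn_mapsTo_ball_deriv_ne_zero {U : Set ℂ} (hU : IsOpen U)
    (hUc : IsSimplyConnected U) (hne : U ≠ univ) {x₀ : ℂ} (hx₀ : x₀ ∈ U) :
    ∃ f : ℂ → ℂ, DifferentiableOn ℂ f U ∧ InjOn f U ∧ MapsTo f U (ball 0 1) ∧ f x₀ = 0 ∧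
      deriv f x₀ ≠ 0 := by
  obtain ⟨a, ha⟩ := (ne_univ_iff_exists_notMem U).1 hne
  obtain ⟨s, hsc, hsq⟩ := Complex.exists_continuousOn_pow_eq hUc hU (g := fun z ↦ z - a)
    (by fun_prop)
    (by
      rintro ⟨z, hz, hza⟩
      exact ha (sub_eq_zero.1 hza ▸ hz)) two_ne_zero
  have hg0 : ∀ z ∈ U, z - a ≠ 0 := fun z hz h ↦ ha (sub_eq_zero.1 h ▸ hz)
  have hs0 : ∀ z ∈ U, s z ≠ 0 := fun z hz h ↦ hg0 z hz (by rw [← hsq, h]; simp)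
  have hsd : ∀ z ∈ U, HasDerivAt s (1 / (2 * s z)) z := fun z hz ↦
    hasDerivAt_of_sq_eq hU hsc hsq hz (hg0 z hz) ((hasDerivAt_id z).sub_const a)
  have hsinj : ∀ z w, s z = s w → z = w := fun z w h ↦ by
    have := hsq z
    rw [h, hsq w] at this
    exact (sub_left_injective this).symm
  have hsdiff : DifferentiableOn ℂ s U := fun z hz ↦
    (hsd z hz).differentiableAt.differentiableWithinAt
  have hopen : IsOpen (s '' U) := by
    refine ((hsdiff.analyticOnNhd hU).is_constant_or_isOpen
      hUc.isPathConnected.isConnected.isPreconnected).resolve_left ?_ U Subset.rfl hU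
    rintro ⟨w, hw⟩
    have h1 : s =ᶠ[𝓝 x₀] fun _ ↦ w := (hU.eventually_mem hx₀).mono hw
    have h2 := ((hasDerivAt_const x₀ w).congr_of_eventuallyEq h1).unique (hsd x₀ hx₀)
    exact one_div_ne_zero (mul_ne_zero two_ne_zero (hs0 x₀ hx₀)) h2.symm
  obtain ⟨ε, hε, hball⟩ := Metric.isOpen_iff.1 hopen (s x₀) (mem_image_of_mem s hx₀)
  have hfar : ∀ z ∈ U, ε ≤ ‖s z + s x₀‖ := by
    intro z hz
    by_contra! hlt
    obtain ⟨w, hw, hwz⟩ := hball (show -s z ∈ ball (s x₀) ε by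
      rw [mem_ball, dist_eq_norm, ← norm_neg]
      simpa [add_comm] using hlt)
    have hzw : z = w := by
      have h := hsq w
      rw [hwz, neg_sq, hsq z] at h
      exact sub_left_injective h
    rw [hzw] at hwz
    exact hs0 w hw (self_eq_neg.1 hwz)
  have hne0 : ∀ z ∈ U, s z + s x₀ ≠ 0 := fun z hz ↦ norm_pos_iff.1 (hε.trans_le (hfar z hz))
  set c : ℂ := ((ε / 2 : ℝ) : ℂ) with hc_def
  have hc0 : c ≠ 0 := Complex.ofReal_ne_zero.2 (by positivity)
  let q : ℂ → ℂ := fun z ↦ c / (s z + s x₀)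
  have hqd : ∀ z ∈ U, HasDerivAt q (-c * (1 / (2 * s z)) / (s z + s x₀) ^ 2) z := fun z hz ↦
    ((hasDerivAt_const z c).fun_div ((hsd z hz).add_const (s x₀)) (hne0 z hz)).congr_deriv
      (by ring)
  have hqmaps : MapsTo q U (ball 0 1) := by
    intro z hz
    have h1 : ‖c‖ = ε / 2 := by
      rw [hc_def, Complex.norm_real, Real.norm_of_nonneg (by positivity)]
    have h2 := hfar z hz
    rw [mem_ball_zero_iff, norm_div, h1, div_lt_one (hε.trans_le h2)]
    linarith
  have hqinj : InjOn q U := by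
    intro z hz w hw h
    have h1 := (div_eq_div_iff (hne0 z hz) (hne0 w hw)).1 h
    exact hsinj z w (add_right_cancel (mul_left_cancel₀ hc0 h1)).symm
  have hqx := mem_ball_zero_iff.1 (hqmaps hx₀)
  refine ⟨discAut (q x₀) ∘ q, (differentiableOn_discAut hqx).comp
    (fun z hz ↦ (hqd z hz).differentiableAt.differentiableWithinAt) hqmaps,
    (injOn_discAut hqx).comp hqinj hqmaps, (mapsTo_discAut hqx).comp hqmaps, discAut_self _, ?_⟩
  rw [((hasDerivAt_discAut hqx hqx).comp x₀ (hqd x₀ hx₀)).deriv]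
  refine mul_ne_zero (div_ne_zero ?_ (pow_ne_zero 2 ?_)) (div_ne_zero (mul_ne_zero
    (neg_ne_zero.2 hc0) (one_div_ne_zero (mul_ne_zero two_ne_zero (hs0 x₀ hx₀))))
    (pow_ne_zero 2 (hne0 x₀ hx₀)))
  all_goals exact one_sub_conj_mul_self_ne_zero hqx

/-- The derivative at a point is maximized among normalized conformal embeddings into the disk. -/
theorem exists_isMaxOn_norm_deriv {U : Set ℂ} (hU : IsOpen U) (hUc : IsPreconnected U)
    {x₀ : ℂ} (hx₀ : x₀ ∈ U) {f₀ : ℂ → ℂ} (hd₀ : DifferentiableOn ℂ f₀ U) (hinj₀ : InjOn f₀ U)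
    (hmaps₀ : MapsTo f₀ U (ball 0 1)) (hf₀ : f₀ x₀ = 0) (hf₀' : deriv f₀ x₀ ≠ 0) :
    ∃ f : ℂ → ℂ, (DifferentiableOn ℂ f U ∧ InjOn f U ∧ MapsTo f U (ball 0 1) ∧ f x₀ = 0) ∧
      deriv f x₀ ≠ 0 ∧ ∀ g : ℂ → ℂ, DifferentiableOn ℂ g U → InjOn g U →
        MapsTo g U (ball 0 1) → g x₀ = 0 → ‖deriv g x₀‖ ≤ ‖deriv f x₀‖ := by
  let 𝓕 : Set (ℂ → ℂ) :=
    {f | DifferentiableOn ℂ f U ∧ InjOn f U ∧ MapsTo f U (ball 0 1) ∧ f x₀ = 0}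
  let S : Set ℝ := (fun f : ℂ → ℂ ↦ ‖deriv f x₀‖) '' 𝓕
  have hS₀ : ‖deriv f₀ x₀‖ ∈ S := mem_image_of_mem _ ⟨hd₀, hinj₀, hmaps₀, hf₀⟩
  have hSb : BddAbove S := by
    obtain ⟨r, hr, hrU⟩ := Metric.isOpen_iff.1 hU x₀ hx₀
    refine ⟨1 / r, ?_⟩
    rintro _ ⟨f, ⟨hd, -, hm, h0⟩, rfl⟩
    refine Complex.norm_deriv_le_div_of_mapsTo_ball (hd.mono hrU) (fun z hz ↦ ?_) hr
    rw [h0]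
    exact ball_subset_closedBall (hm (hrU hz))
  obtain ⟨u, -, hu, huS⟩ := exists_seq_tendsto_sSup ⟨_, hS₀⟩ hSb
  choose F hF hFu using huS
  let l : Ultrafilter ℕ := Filter.hyperfilter ℕ
  have hl : (l : Filter ℕ) ≤ atTop := Nat.hyperfilter_le_atTop
  obtain ⟨f, hf, hfb⟩ := exists_tendstoLocallyUniformlyOn_ultrafilter l hU
    (fun n ↦ (hF n).1) (fun n ↦ (hF n).2.2.1)
  have hFd := Filter.Eventually.of_forall (f := (l : Filter ℕ)) fun n ↦ (hF n).1
  have hfd : DifferentiableOn ℂ f U := hf.differentiableOn hFd hU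
  have hlim : ‖deriv f x₀‖ = sSup S := by
    refine tendsto_nhds_unique ((hf.deriv hFd hU).tendsto_at hx₀).norm ?_
    refine (hu.mono_left hl).congr fun n ↦ ?_
    exact (hFu n).symm
  have hpos : deriv f x₀ ≠ 0 := by
    rw [← norm_pos_iff, hlim]
    exact (norm_pos_iff.2 hf₀').trans_le (le_csSup hSb hS₀)
  have hnc : ¬ ∃ w, ∀ z ∈ U, f z = w := by
    rintro ⟨w, hw⟩
    have h1 : f =ᶠ[𝓝 x₀] fun _ ↦ w := (hU.eventually_mem hx₀).mono hw
    exact hpos (by rw [h1.deriv_eq, deriv_const])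
  have hopen : IsOpen (f '' U) :=
    ((hfd.analyticOnNhd hU).is_constant_or_isOpen hUc).resolve_left hnc U Subset.rfl hU
  refine ⟨f, ⟨hfd, hf.injOn_of_not_constant hU hUc (fun n ↦ (hF n).1) (fun n ↦ (hF n).2.1) hnc,
    ?_, ?_⟩, hpos, fun g h1 h2 h3 h4 ↦ ?_⟩
  · rw [mapsTo_iff_image_subset, ← interior_closedBall (0 : ℂ) one_ne_zero]
    exact interior_maximal hfb.image_subset hopen
  · refine tendsto_nhds_unique (hf.tendsto_at hx₀) ?_
    simp only [(hF _).2.2.2]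
    exact tendsto_const_nhds
  · rw [hlim]
    exact le_csSup hSb (mem_image_of_mem _ ⟨h1, h2, h3, h4⟩)

/-- Koebe's trick: a normalized conformal embedding into the disk which is not onto can be
replaced by one with a larger derivative. -/
theorem exists_norm_deriv_lt_of_notMem_image {U : Set ℂ} (hU : IsOpen U)
    (hUc : IsSimplyConnected U) {x₀ : ℂ} (hx₀ : x₀ ∈ U) {f : ℂ → ℂ}
    (hd : DifferentiableOn ℂ f U) (hinj : InjOn f U) (hmaps : MapsTo f U (ball 0 1))
    (hf0 : f x₀ = 0) (hf' : deriv f x₀ ≠ 0) {w : ℂ} (hw : w ∈ ball (0 : ℂ) 1)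
    (hwf : w ∉ f '' U) :
    ∃ g : ℂ → ℂ, DifferentiableOn ℂ g U ∧ InjOn g U ∧ MapsTo g U (ball 0 1) ∧ g x₀ = 0 ∧
      ‖deriv f x₀‖ < ‖deriv g x₀‖ := by
  have hw1 := mem_ball_zero_iff.1 hw
  let p : ℂ → ℂ := discAut w ∘ f
  have hpd : DifferentiableOn ℂ p U := (differentiableOn_discAut hw1).comp hd hmaps
  have hpmaps : MapsTo p U (ball 0 1) := (mapsTo_discAut hw1).comp hmaps
  have hp0 : ∀ z ∈ U, p z ≠ 0 := fun z hz h ↦ by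
    refine hwf ⟨z, hz, injOn_discAut hw1 (hmaps hz) hw ?_⟩
    rw [discAut_self]
    exact h
  obtain ⟨s, hsc, hsq⟩ := Complex.exists_continuousOn_pow_eq hUc hU hpd.continuousOn
    (by rintro ⟨z, hz, h⟩; exact hp0 z hz h) two_ne_zero
  have hsd : ∀ z ∈ U, HasDerivAt s (deriv p z / (2 * s z)) z := fun z hz ↦
    hasDerivAt_of_sq_eq hU hsc hsq hz (hp0 z hz)
      ((hpd.differentiableAt (hU.mem_nhds hz)).hasDerivAt)
  have hsdiff : DifferentiableOn ℂ s U := fun z hz ↦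
    (hsd z hz).differentiableAt.differentiableWithinAt
  have hsmaps : MapsTo s U (ball 0 1) := by
    intro z hz
    have h := mem_ball_zero_iff.1 (hpmaps hz)
    rw [← hsq, norm_pow] at h
    exact mem_ball_zero_iff.2 ((pow_lt_one_iff_of_nonneg (norm_nonneg _) two_ne_zero).1 h)
  have hsinj : InjOn s U := by
    intro y hy z hz h
    refine ((injOn_discAut hw1).comp hinj hmaps) hy hz ?_
    change p y = p z
    rw [← hsq, ← hsq, h]
  have hs1 := mem_ball_zero_iff.1 (hsmaps hx₀)
  refine ⟨discAut (s x₀) ∘ s, (differentiableOn_discAut hs1).comp hsdiff hsmaps,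
    (injOn_discAut hs1).comp hsinj hsmaps, (mapsTo_discAut hs1).comp hsmaps, discAut_self _, ?_⟩
  have hpx : p x₀ = -w := by simp [p, hf0]
  have hpderiv : deriv p x₀ = (1 - conj w * w) * deriv f x₀ := by
    have h1 : HasDerivAt (discAut w) (1 - conj w * w) (f x₀) := by
      rw [hf0]
      simpa using hasDerivAt_discAut hw1 (z := 0) (by simp)
    exact (h1.comp x₀ (hd.differentiableAt (hU.mem_nhds hx₀)).hasDerivAt).deriv
  rw [((hasDerivAt_discAut hs1 hs1).comp x₀ (hsd x₀ hx₀)).deriv, hpderiv]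
  have hs0 : s x₀ ≠ 0 := fun h ↦ hp0 x₀ hx₀ (by rw [← hsq, h]; simp)
  have hconj : ∀ a : ℂ, conj a * a = ((‖a‖ ^ 2 : ℝ) : ℂ) := fun a ↦ by
    rw [Complex.conj_mul', Complex.ofReal_pow]
  set t := ‖s x₀‖ with ht_def
  have ht : 0 < t := norm_pos_iff.2 hs0
  have hwt : ‖w‖ = t ^ 2 := by rw [← norm_neg, ← hpx, ← hsq, norm_pow]
  have hnorm : ∀ x : ℝ, x < 1 → ‖(1 : ℂ) - (x : ℂ)‖ = 1 - x := fun x hx ↦ by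
    rw [← Complex.ofReal_one, ← Complex.ofReal_sub, Complex.norm_real,
      Real.norm_of_nonneg (by linarith)]
  have ht2 : t ^ 2 < 1 := by nlinarith
  have hpos : 0 < ‖deriv f x₀‖ := norm_pos_iff.2 hf'
  rw [norm_mul, norm_div, norm_div, norm_pow, norm_mul, norm_mul, hconj, hconj, hnorm _ ht2,
    hnorm _ (by rw [hwt]; nlinarith), hwt, ← ht_def, Complex.norm_ofNat]
  have h1 : (1 - t ^ 2) / (1 - t ^ 2) ^ 2 * ((1 - (t ^ 2) ^ 2) * ‖deriv f x₀‖ / (2 * t))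
      = ‖deriv f x₀‖ * ((1 + t ^ 2) / (2 * t)) := by
    have : 1 - t ^ 2 ≠ 0 := by linarith
    field_simp
    ring
  rw [h1]
  refine lt_mul_of_one_lt_right hpos ((one_lt_div (by positivity)).2 ?_)
  nlinarith [sq_pos_of_pos (sub_pos.2 hs1)]

theorem exists_conformalMapOnto_ball {U : Set ℂ} (hU : IsOpen U)
    (hUc : IsSimplyConnected U) (hne : U ≠ univ) :
    ∃ f : ℂ → ℂ, ConformalMapOnto f U (ball 0 1) := by
  obtain ⟨x₀, hx₀⟩ := hUc.nonempty
  obtain ⟨f₀, h1, h2, h3, h4, h5⟩ := exists_injOn_mapsTo_ball_deriv_ne_zero hU hUc hne hx₀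
  obtain ⟨f, ⟨hd, hinj, hmaps, hf0⟩, hf', hmax⟩ := exists_isMaxOn_norm_deriv hU
    hUc.isPathConnected.isConnected.isPreconnected hx₀ h1 h2 h3 h4 h5
  refine ⟨f, hd, hinj, hmaps.image_subset.antisymm fun w hw ↦ ?_⟩
  by_contra hwf
  obtain ⟨g, g1, g2, g3, g4, g5⟩ :=
    exists_norm_deriv_lt_of_notMem_image hU hUc hx₀ hd hinj hmaps hf0 hf' hw hwf
  exact (hmax g g1 g2 g3 g4).not_gt g5

/-- The inverse of an injective holomorphic function on a domain is holomorphic. -/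
theorem ConformalMapOnto.differentiableOn_invFunOn {g : ℂ → ℂ} {U V : Set ℂ} (hU : IsOpen U)
    (hUc : IsConnected U) (hg : ConformalMapOnto g U V) :
    DifferentiableOn ℂ (Function.invFunOn g U) V := by
  obtain ⟨hd, hinj, rfl⟩ := hg
  set k := Function.invFunOn g U
  have hk : ∀ z ∈ U, k (g z) = z := hinj.leftInvOn_invFunOn
  have ha := hd.analyticOnNhd hU
  have hnc : ∀ z ∈ U, ¬ ∀ᶠ y in 𝓝 z, g y = g z := fun z hz h ↦ by
    have h1 : ∀ᶠ y in 𝓝[≠] z, y = z := by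
      filter_upwards [h.filter_mono nhdsWithin_le_nhds,
        (hU.eventually_mem hz).filter_mono nhdsWithin_le_nhds] with y hy hyU
      exact hinj hyU hz hy
    obtain ⟨y, hy, hy'⟩ := (h1.and self_mem_nhdsWithin).exists
    exact hy' hy
  have hopen : ∀ s ⊆ U, IsOpen s → IsOpen (g '' s) := by
    refine (ha.is_constant_or_isOpen hUc.isPreconnected).resolve_left ?_
    rintro ⟨w, hw⟩
    obtain ⟨z, hz⟩ := hUc.nonempty
    exact hnc z hz ((hU.eventually_mem hz).mono fun y hy ↦ (hw y hy).trans (hw z hz).symm)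
  have hV : IsOpen (g '' U) := hopen U Subset.rfl hU
  have hcont : ∀ z ∈ U, ContinuousAt k (g z) := by
    intro z hz
    rw [ContinuousAt, hk z hz, _root_.tendsto_nhds]
    intro s hs hzs
    refine mem_of_superset ((hopen (s ∩ U) inter_subset_right (hs.inter hU)).mem_nhds
      (mem_image_of_mem g ⟨hzs, hz⟩)) ?_
    rintro _ ⟨y, ⟨hys, hyU⟩, rfl⟩
    rwa [mem_preimage, hk y hyU]
  rintro _ ⟨z, hz, rfl⟩
  refine (analyticAt_of_differentiable_on_punctured_nhds_of_continuousAt ?_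
    (hcont z hz)).differentiableAt.differentiableWithinAt
  have hderiv : ∀ᶠ y in 𝓝[≠] z, deriv g y ≠ 0 := by
    refine ((ha z hz).deriv.eventually_eq_zero_or_eventually_ne_zero).resolve_left fun h ↦ ?_
    obtain ⟨r, hr, hrz⟩ := Metric.nhds_basis_ball.eventually_iff.1
      ((hU.eventually_mem hz).and h)
    refine hnc z hz ((isOpen_ball.eventually_mem (mem_ball_self hr)).mono fun y hy ↦ ?_)
    exact (convex_ball z r).is_const_of_fderivWithin_eq_zero (𝕜 := ℂ)
      (hd.mono fun x hx ↦ (hrz hx).1) (fun x hx ↦ by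
        have hx' := ((hd.differentiableAt (hU.mem_nhds (hrz hx).1)).hasDerivAt)
        rw [(hrz hx).2] at hx'
        rw [fderivWithin_of_isOpen isOpen_ball hx, hx'.hasFDerivAt.fderiv]
        simp) hy (mem_ball_self hr)
  have hktend : Tendsto k (𝓝[≠] (g z)) (𝓝[≠] z) := by
    refine tendsto_nhdsWithin_of_tendsto_nhds_of_eventually_within _ ?_ ?_
    · simpa only [hk z hz] using (hcont z hz).tendsto.mono_left nhdsWithin_le_nhds
    · filter_upwards [self_mem_nhdsWithin,
        (hV.eventually_mem (mem_image_of_mem g hz)).filter_mono nhdsWithin_le_nhds]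
      rintro _ hne ⟨y, hy, rfl⟩ h
      rw [mem_singleton_iff, hk y hy] at h
      exact hne (h ▸ rfl)
  filter_upwards [hktend.eventually hderiv,
    (hV.eventually_mem (mem_image_of_mem g hz)).filter_mono nhdsWithin_le_nhds]
  rintro _ h ⟨y, hy, rfl⟩
  rw [hk y hy] at h
  refine (HasDerivAt.of_local_left_inverse (f := g) (f' := deriv g y) (hcont y hy) ?_ h
    ?_).differentiableAt
  · rw [hk y hy]
    exact (hd.differentiableAt (hU.mem_nhds hy)).hasDerivAt
  · filter_upwards [hV.eventually_mem (mem_image_of_mem g hy)]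
    rintro _ ⟨x, hx, rfl⟩
    rw [hk x hx]

/-- Mutually inverse holomorphic self-maps of the unit disk are Möbius transformations. -/
theorem isMobiusOn_ball_of_leftInvOn {h k : ℂ → ℂ} (hh : DifferentiableOn ℂ h (ball 0 1))
    (hk : DifferentiableOn ℂ k (ball 0 1)) (hhm : MapsTo h (ball 0 1) (ball 0 1))
    (hkm : MapsTo k (ball 0 1) (ball 0 1)) (hkh : LeftInvOn k h (ball 0 1)) :
    IsMobiusOn h (ball 0 1) := by
  have h0 : (0 : ℂ) ∈ ball (0 : ℂ) 1 := mem_ball_self one_pos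
  set a := h 0
  have ha : ‖a‖ < 1 := mem_ball_zero_iff.1 (hhm h0)
  have hna : ‖-a‖ < 1 := by rwa [norm_neg]
  let T : ℂ → ℂ := discAut a ∘ h
  let S : ℂ → ℂ := k ∘ discAut (-a)
  have hTd : DifferentiableOn ℂ T (ball 0 1) := (differentiableOn_discAut ha).comp hh hhm
  have hSd : DifferentiableOn ℂ S (ball 0 1) :=
    hk.comp (differentiableOn_discAut hna) (mapsTo_discAut hna)
  have hTm : MapsTo T (ball 0 1) (ball 0 1) := (mapsTo_discAut ha).comp hhm
  have hSm : MapsTo S (ball 0 1) (ball 0 1) := hkm.comp (mapsTo_discAut hna)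
  have hT0 : T 0 = 0 := discAut_self a
  have hTh : ∀ z ∈ ball (0 : ℂ) 1, discAut (-a) (T z) = h z := fun z hz ↦
    discAut_neg_discAut ha (mem_ball_zero_iff.1 (hhm hz))
  have hST : ∀ z ∈ ball (0 : ℂ) 1, S (T z) = z := fun z hz ↦
    (congrArg k (hTh z hz)).trans (hkh hz)
  have hS0 : S 0 = 0 := by
    have := hST 0 h0
    rwa [hT0] at this
  have hTnorm : ∀ z ∈ ball (0 : ℂ) 1, ‖T z‖ = ‖z‖ := fun z hz ↦ by
    refine le_antisymm (Complex.norm_le_norm_of_mapsTo_ball hTd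
      (hTm.mono_right ball_subset_closedBall) hT0 (mem_ball_zero_iff.1 hz)) ?_
    have h1 := Complex.norm_le_norm_of_mapsTo_ball hSd
      (hSm.mono_right ball_subset_closedBall) hS0 (mem_ball_zero_iff.1 (hTm hz))
    rwa [hST z hz] at h1
  have hhalf : (1 / 2 : ℂ) ∈ ball (0 : ℂ) 1 := by
    rw [mem_ball_zero_iff]
    norm_num
  obtain ⟨C, hC, hTC⟩ := Complex.affine_of_mapsTo_ball_of_exists_norm_dslope_eq_div' hTd
    (by rw [hT0]; exact hTm.mono_right ball_subset_closedBall)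
    ⟨1 / 2, hhalf, by
      rw [dslope_of_ne _ (by norm_num), slope_def_field, hT0, sub_zero, sub_zero, norm_div,
        hTnorm _ hhalf, div_self (by norm_num), div_one]⟩
  have hC0 : C ≠ 0 := norm_pos_iff.1 (by rw [hC]; norm_num)
  have hTz : ∀ z ∈ ball (0 : ℂ) 1, T z = C * z := fun z hz ↦ by
    rw [hTC hz]
    simp [hT0, mul_comm]
  refine ⟨C, a, conj a * C, 1, ?_, fun z hz ↦ ?_⟩
  · rw [show C * 1 - a * (conj a * C) = C * (1 - conj a * a) by ring]
    exact mul_ne_zero hC0 (one_sub_conj_mul_self_ne_zero ha)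
  · have h1 := one_sub_conj_mul_ne_zero hna (mem_ball_zero_iff.1 (hTm hz))
    have h2 : 1 - conj (-a) * T z = conj a * C * z + 1 := by
      rw [hTz z hz, map_neg]
      ring
    refine ⟨h2 ▸ h1, ?_⟩
    rw [← hTh z hz, discAut, h2, hTz z hz, sub_neg_eq_add]

lemma ConformalMapOnto.mapsTo_comp_invFunOn {f g : ℂ → ℂ} {U V W : Set ℂ}
    (hf : ConformalMapOnto f U V) (hg : ConformalMapOnto g U W) :
    MapsTo (fun w ↦ f (Function.invFunOn g U w)) W V := by
  obtain ⟨-, -, rfl⟩ := hf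
  obtain ⟨-, hinj, rfl⟩ := hg
  rintro _ ⟨z, hz, rfl⟩
  exact mem_image_of_mem f ((hinj.leftInvOn_invFunOn hz).symm ▸ hz)

lemma ConformalMapOnto.differentiableOn_comp_invFunOn {f g : ℂ → ℂ} {U V W : Set ℂ}
    (hU : IsOpen U) (hUc : IsConnected U) (hf : ConformalMapOnto f U V)
    (hg : ConformalMapOnto g U W) :
    DifferentiableOn ℂ (fun w ↦ f (Function.invFunOn g U w)) W := by
  refine hf.1.comp (hg.differentiableOn_invFunOn hU hUc) ?_
  obtain ⟨-, hinj, rfl⟩ := hg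
  rintro _ ⟨z, hz, rfl⟩
  rwa [hinj.leftInvOn_invFunOn hz]

lemma ConformalMapOnto.leftInvOn_comp_invFunOn {f g : ℂ → ℂ} {U V W : Set ℂ}
    (hf : ConformalMapOnto f U V) (hg : ConformalMapOnto g U W) :
    LeftInvOn (fun w ↦ g (Function.invFunOn f U w)) (fun w ↦ f (Function.invFunOn g U w)) W := by
  obtain ⟨-, hinj, rfl⟩ := hg
  rintro _ ⟨z, hz, rfl⟩
  simp only [hinj.leftInvOn_invFunOn hz, hf.2.1.leftInvOn_invFunOn hz]

end

/-- **Riemann mapping theorem.** Every simply connected domain `Ω ⊊ ℂ` admits a conformal map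
onto the unit disk, and any two such maps differ by a Möbius transformation. -/
theorem riemann_mapping_theorem (Ω : Set ℂ) (hopen : IsOpen Ω) (hconn : IsConnected Ω)
    (hne : Ω ≠ Set.univ) (hsc : SimplyConnectedSpace ↥Ω) :
    (∃ f : ℂ → ℂ, ConformalMapOnto f Ω (Metric.ball 0 1)) ∧
    ∀ f g : ℂ → ℂ, ConformalMapOnto f Ω (Metric.ball 0 1) →
      ConformalMapOnto g Ω (Metric.ball 0 1) →
      IsMobiusOn (fun w => f (Function.invFunOn g Ω w)) (Metric.ball 0 1) := by
  refine ⟨exists_conformalMapOnto_ball hopen hsc hne, fun f g hf hg ↦ ?_⟩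
  exact isMobiusOn_ball_of_leftInvOn (hf.differentiableOn_comp_invFunOn hopen hconn hg)
    (hg.differentiableOn_comp_invFunOn hopen hconn hf) (hf.mapsTo_comp_invFunOn hg)
    (hg.mapsTo_comp_invFunOn hf) (hf.leftInvOn_comp_invFunOn hg)
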